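/- Corollary of the main theorem (original Conca–Herzog conjecture): with Y a one-sided ladder region, P_i = (i,n) and Q_i = (m,i) for i = 1,…,r points of Y, one has t^{-\binom{r}{2}} det[W_Y(P_i, Q_j)]_{i,j=1,…,r} = W_Y(P, Q), where W_Y(P_i,Q_j) is the polynomial counting single paths in Y from P_i to Q_j by corners and W_Y(P,Q) counts r-tuples of pairwise disjoint paths from P_i to Q_i in Y by total corners. -/

import Mathlib

open Polynomial Finset

/-- The order on the grid: `(i,j) ≤ (i',j')` iff `i' ≤ i` and `j ≤ j'`. -/
def ple (x y : ℕ × ℕ) : Prop := y.1 ≤ x.1 ∧ x.2 ≤ y.2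

/-- `C` is a path from `P` to `Q` inside the region `Y`: a maximal chain (for the order
`ple`) in `Y` with end points `P` and `Q`. -/
def IsPath (Y : Set (ℕ × ℕ)) (P Q : ℕ × ℕ) (C : Finset (ℕ × ℕ)) : Prop :=
  (C : Set (ℕ × ℕ)) ⊆ Y ∧ P ∈ C ∧ Q ∈ C ∧
  (∀ x ∈ C, ple Q x ∧ ple x P) ∧
  (∀ x ∈ C, ∀ y ∈ C, ple x y ∨ ple y x) ∧
  (∀ z ∈ Y, ple Q z → ple z P → (∀ x ∈ C, ple x z ∨ ple z x) → z ∈ C)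

/-- Number of corners of a path: points `(i,j) ∈ C` with `(i-1,j) ∈ C` and `(i,j-1) ∈ C`. -/
def cornersCount (C : Finset (ℕ × ℕ)) : ℕ :=
  (C.filter (fun p => (p.1 - 1, p.2) ∈ C ∧ (p.1, p.2 - 1) ∈ C)).card

/-- Number of paths from `P` to `Q` in `Y` with exactly `k` corners. -/
noncomputable def pathCount (Y : Set (ℕ × ℕ)) (P Q : ℕ × ℕ) (k : ℕ) : ℕ :=
  Set.ncard {C : Finset (ℕ × ℕ) | IsPath Y P Q C ∧ cornersCount C = k}

/-- Corner-counting generating polynomial for single paths; `N` is any bound larger than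
the possible number of corners, so that the sum agrees with `∑_{k ≥ 0} w_k(P,Q) tᵏ`. -/
noncomputable def Wpoly (Y : Set (ℕ × ℕ)) (P Q : ℕ × ℕ) (N : ℕ) : Polynomial ℚ :=
  ∑ k ∈ Finset.range N, (pathCount Y P Q k : Polynomial ℚ) * X ^ k

/-- Number of `r`-tuples of pairwise disjoint paths from `P i` to `Q i` in `Y` with `k`
corners in total. -/
noncomputable def tupleCount (Y : Set (ℕ × ℕ)) {r : ℕ} (P Q : Fin r → ℕ × ℕ) (k : ℕ) : ℕ :=
  Set.ncard {C : Fin r → Finset (ℕ × ℕ) |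
    (∀ i, IsPath Y (P i) (Q i) (C i)) ∧ (∀ i j, i ≠ j → Disjoint (C i) (C j)) ∧
    ∑ i, cornersCount (C i) = k}

/-- Total number of `r`-tuples of pairwise disjoint paths from `P i` to `Q i` in `Y`. -/
noncomputable def tupleCountAll (Y : Set (ℕ × ℕ)) {r : ℕ} (P Q : Fin r → ℕ × ℕ) : ℕ :=
  Set.ncard {C : Fin r → Finset (ℕ × ℕ) |
    (∀ i, IsPath Y (P i) (Q i) (C i)) ∧ (∀ i j, i ≠ j → Disjoint (C i) (C j))}

/-- Corner-counting generating polynomial for `r`-tuples of non-intersecting paths. -/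
noncomputable def WTpoly (Y : Set (ℕ × ℕ)) {r : ℕ} (P Q : Fin r → ℕ × ℕ) (N : ℕ) :
    Polynomial ℚ :=
  ∑ k ∈ Finset.range N, (tupleCount Y P Q k : Polynomial ℚ) * X ^ k

/-- Rectangular grid region `{(i,j) : 1 ≤ i ≤ m, 1 ≤ j ≤ n}`. -/
def grid (m n : ℕ) : Set (ℕ × ℕ) :=
  {p | 1 ≤ p.1 ∧ p.1 ≤ m ∧ 1 ≤ p.2 ∧ p.2 ≤ n}

/-- One-sided ladder-shaped region with (weakly decreasing) height function `h`. -/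
def ladder (m n : ℕ) (h : ℕ → ℕ) : Set (ℕ × ℕ) :=
  {p | 1 ≤ p.1 ∧ p.1 ≤ m ∧ 1 ≤ p.2 ∧ p.2 ≤ n ∧ p.2 ≤ h p.1}

namespace CH

noncomputable def Dt {s : ℕ} (r : Fin s → Fin (s+1) → ℚ[X]) (v : Fin (s+1) → ℚ[X]) : ℚ[X] :=
  Matrix.det (Matrix.of (Fin.snoc (α := fun _ => Fin (s+1) → ℚ[X]) r v))

lemma Dt_add {s : ℕ} (r : Fin s → Fin (s+1) → ℚ[X]) (u v : Fin (s+1) → ℚ[X]) (c : ℚ[X]) :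
    Dt r (u + c • v) = Dt r u + c * Dt r v := by
  have key : ∀ w, Dt r w = Matrix.det (Matrix.updateRow (Matrix.of (Fin.snoc (α := fun _ => Fin (s+1) → ℚ[X]) r 0)) (Fin.last s) w) := by
    intro w
    unfold Dt
    congr 1
    ext i j
    refine Fin.lastCases ?_ (fun i => ?_) i
    · simp
    · rw [Matrix.updateRow_ne (Fin.castSucc_lt_last i).ne]
      simp
  rw [key, key, key, Matrix.det_updateRow_add, Matrix.det_updateRow_smul]

lemma Dt_row {s : ℕ} (r : Fin s → Fin (s+1) → ℚ[X]) (v : Fin (s+1) → ℚ[X]) (g : Fin s → ℚ[X]) :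
    Dt (fun i => r i + g i • v) v = Dt r v := by
  unfold Dt
  refine Matrix.det_eq_of_forall_row_eq_smul_add_const (Fin.snoc (α := fun _ => ℚ[X]) g 0) (Fin.last s) (by simp) ?_
  intro i j
  refine Fin.lastCases ?_ (fun i => ?_) i
  · simp
  · simp

lemma Dt_zero {s : ℕ} (r : Fin s → Fin (s+1) → ℚ[X]) : Dt r 0 = 0 := by
  have := Dt_add r 0 0 1
  simpa using this

lemma step {s : ℕ} (r : Fin s → Fin (s+1) → ℚ[X]) (rs v w : Fin (s+1) → ℚ[X])
    (g : Fin s → ℚ[X]) (gs : ℚ[X]) (hyp : (∀ i, g i = 0) ∨ rs = gs • w) :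
    Dt (fun i => r i + g i • v) (rs + gs • v) =
      Dt r rs + gs * Dt (fun i => r i - g i • w) v := by
  rcases hyp with hg | rfl
  · simp only [hg, zero_smul, add_zero, sub_zero]
    rw [Dt_add]
  · have e1 : ∀ (q : Fin s → Fin (s+1) → ℚ[X]) u, Dt q (gs • u) = gs * Dt q u := by
      intro q u
      have := Dt_add q 0 u gs
      simpa [Dt_zero] using this
    rw [← smul_add, e1, e1, ← mul_add]
    congr 1
    have e2 : Dt r w = Dt (fun i => r i - g i • w) w := by
      rw [← Dt_row (fun i => r i - g i • w) w g]; simp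
    have e3 : Dt (fun i => r i + g i • v) (w + v) = Dt (fun i => r i - g i • w) (w + v) := by
      rw [← Dt_row (fun i => r i - g i • w) (w+v) g]
      congr 1; ext1 i; module
    rw [e2, e3]
    have := Dt_add (fun i => r i - g i • w) w v 1
    simpa using this

lemma tele {s : ℕ} (N : ℕ) (g : Fin s → ℕ → ℚ[X]) (gs : ℕ → ℚ[X]) (V : ℕ → Fin (s+1) → ℚ[X])
    (hyp : ∀ K < N, (∀ i, g i K = 0) ∨ ∀ b < K, gs b = gs K) :
    Dt (fun i => ∑ b ∈ range N, g i b • V b) (∑ b ∈ range N, gs b • V b) =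
      ∑ K ∈ range N, gs K * Dt (fun i => ∑ b ∈ range K, (g i b - g i K) • V b) (V K) := by
  induction N with
  | zero => simp [Dt_zero]
  | succ N ih =>
    simp only [sum_range_succ]
    rw [← ih (fun K hK => hyp K (by omega)), step _ _ _ (∑ b ∈ range N, V b)]
    · congr 3
      ext1 i
      simp only [sub_smul, sum_sub_distrib, smul_sum]
    · rcases hyp N (by omega) with h | h
      · exact Or.inl h
      · right
        rw [smul_sum]
        exact sum_congr rfl fun b hb => by rw [h b (mem_range.1 hb)]


def Val (j : ℕ) : List ℕ → ℕ → List ℕ → Prop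
  | [], A, [] => A = j
  | H :: hs, A, K :: ks => A ≤ H ∧ 1 ≤ K ∧ K ≤ A ∧ Val j hs K ks
  | [], _, _ :: _ => False
  | _ :: _, _, [] => False

def LP (j : ℕ) : List ℕ → ℕ → Finset (List ℕ)
  | [], A => if A = j then {[]} else ∅
  | H :: hs, A => if A ≤ H then (Icc 1 A).biUnion (fun K => (LP j hs K).image (fun ks => K :: ks)) else ∅

lemma mem_LP (j : ℕ) (hs : List ℕ) (A : ℕ) (ks : List ℕ) : ks ∈ LP j hs A ↔ Val j hs A ks := by
  induction hs generalizing A ks with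
  | nil => cases ks <;> simp [LP, Val] <;> split_ifs <;> simp_all
  | cons H hs ih =>
    cases ks with
    | nil => simp [LP, Val]; split_ifs <;> simp
    | cons K ks => 
      simp only [LP, Val]
      split_ifs with h
      · simp [ih, h]; tauto
      · simp [h]

def ex : ℕ → List ℕ → ℕ
  | _, [] => 0
  | A, K :: ks => (if K < A then 1 else 0) + ex K ks

noncomputable def PS (j : ℕ) (hs : List ℕ) (A : ℕ) (φ : List ℕ → ℚ[X]) : ℚ[X] :=
  ∑ ks ∈ LP j hs A, X ^ ex A ks * φ (ks.map Nat.pred)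

noncomputable def T (a b : ℕ) : ℚ[X] := if b < a then X else if b = a then 1 else 0

lemma T_gt {a b : ℕ} (h : a < b) : T a b = 0 := by
  unfold T; rw [if_neg (by omega), if_neg (by omega)]

lemma LP_zero (j : ℕ) (hj : 1 ≤ j) (hs : List ℕ) : LP j hs 0 = ∅ := by
  cases hs with
  | nil => simp only [LP]; rw [if_neg (by omega)]
  | cons H hs => simp [LP]

lemma PS_zero (j : ℕ) (hj : 1 ≤ j) (hs : List ℕ) (φ) : PS j hs 0 φ = 0 := by
  simp [PS, LP_zero j hj]

lemma sum_Icc_range (A : ℕ) (f : ℕ → ℚ[X]) (h0 : f 0 = 0) :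
    ∑ K ∈ Icc 1 A, f K = ∑ K ∈ range (A+1), f K := by
  refine sum_subset (fun x hx => by simp at hx ⊢; omega) ?_
  intro x hx hx'
  have : x = 0 := by simp at hx hx'; omega
  rw [this, h0]

lemma PS_cons (j : ℕ) (hj : 1 ≤ j) (H : ℕ) (hs : List ℕ) (A : ℕ) (φ) (hA : A ≤ H) :
    PS j (H :: hs) A φ =
      ∑ K ∈ range (A+1), T A K * PS j hs K (fun ks => φ ((K-1) :: ks)) := by
  rw [← sum_Icc_range _ _ (by simp [PS_zero j hj])]
  unfold PS
  simp only [LP, hA, if_true]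
  rw [sum_biUnion]
  · refine sum_congr rfl fun K hK => ?_
    rw [sum_image (by simp), mul_sum]
    refine sum_congr rfl fun ks _ => ?_
    simp only [ex, List.map_cons, Nat.pred_eq_sub_one, pow_add, T]
    have := (mem_Icc.1 hK).2
    rw [← mul_assoc]
    congr 2
    rcases this.lt_or_eq with h | h
    · simp [h]
    · simp [h]
  · intro K _ L _ hKL
    rw [Function.onFun, disjoint_left]
    simp
    intro a x hx e y
    exact (hKL y.symm).elim

lemma PS_cons_big (j : ℕ) (H : ℕ) (hs : List ℕ) (A : ℕ) (φ) (hA : ¬ A ≤ H) :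
    PS j (H :: hs) A φ = 0 := by simp [PS, LP, hA]

noncomputable def W (j : ℕ) (hs : List ℕ) (A : ℕ) : ℚ[X] := PS j hs A (fun _ => 1)

lemma W_zero (j : ℕ) (hj : 1 ≤ j) (hs : List ℕ) : W j hs 0 = 0 := PS_zero j hj hs _

lemma W_cons (j : ℕ) (hj : 1 ≤ j) (H : ℕ) (hs : List ℕ) (A : ℕ) :
    W j (H :: hs) A = if A ≤ H then ∑ K ∈ range (A+1), T A K * W j hs K else 0 := by
  split_ifs with h
  · exact PS_cons j hj H hs A _ h
  · exact PS_cons_big j H hs A _ h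

lemma W_nil (j A : ℕ) : W j [] A = if A = j then 1 else 0 := by
  simp [W, PS, LP]; split_ifs <;> simp [ex]

noncomputable def DW (j : ℕ) (hs : List ℕ) (a : ℕ) : ℚ[X] := W j hs a + (X - 1) * W j hs (a-1)

lemma TW_eq (f : ℕ → ℚ[X]) (h0 : f 0 = 0) (A : ℕ) :
    ∑ K ∈ range (A+1), T A K * f K = ∑ b ∈ range (A+1), (f b + (X-1) * f (b-1)) := by
  have h1 : ∑ K ∈ range (A+1), T A K * f K = f A + X * ∑ K ∈ range A, f K := by
    rw [sum_range_succ, mul_sum, add_comm]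
    congr 1
    · simp [T]
    · exact sum_congr rfl fun K hK => by simp [T, mem_range.1 hK]
  rw [h1]
  clear h1
  induction A with
  | zero => simp [h0]
  | succ A ih => 
    rw [sum_range_succ _ (A+1), ← ih, sum_range_succ _ A]
    simp
    ring

lemma W_cons' (j : ℕ) (hj : 1 ≤ j) (H : ℕ) (hs : List ℕ) (A : ℕ) :
    W j (H :: hs) A = if A ≤ H then ∑ b ∈ range (A+1), DW j hs b else 0 := by
  rw [W_cons j hj, TW_eq _ (W_zero j hj hs)]; rfl

lemma DW_zero (j : ℕ) (hj : 1 ≤ j) (hs : List ℕ) : DW j hs 0 = 0 := by simp [DW, W_zero j hj]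

lemma DW_cons (j : ℕ) (hj : 1 ≤ j) (K : ℕ) (hK : 1 ≤ K) (ks : List ℕ) (a : ℕ) :
    DW j ((K-1) :: ks) a = ∑ b ∈ range K, (T a b - T a K) * DW j ks b := by
  rcases Nat.eq_zero_or_pos a with rfl | ha
  · rw [DW_zero j hj]
    symm
    apply sum_eq_zero
    intro b hb
    rcases Nat.eq_zero_or_pos b with rfl | hb'
    · simp [DW_zero j hj]
    · have : T 0 b = 0 := T_gt (by omega)
      have : T 0 K = 0 := T_gt (by omega)
      simp [*]
  obtain ⟨a, rfl⟩ : ∃ c, a = c + 1 := ⟨a-1, by omega⟩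
  rw [DW, W_cons' j hj, W_cons' j hj]
  simp only [Nat.add_sub_cancel]
  rcases lt_trichotomy (a+1) K with h | h | h
  · rw [if_pos (by omega), if_pos (by omega)]
    have h2 : T (a+1) K = 0 := T_gt (by omega)
    obtain ⟨d, rfl⟩ : ∃ d, K = (a+1+1) + d := ⟨K - (a+2), by omega⟩
    rw [sum_range_add _ (a+1+1) d, sum_eq_zero (s := range d), add_zero, sum_range_succ _ (a+1), sum_range_succ _ (a+1), h2]
    · have : ∑ x ∈ range (a + 1), (T (a + 1) x - 0) * DW j ks x = ∑ x ∈ range (a+1), X * DW j ks x :=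
        sum_congr rfl fun b hb => by simp [T, mem_range.1 hb]
      rw [this, ← mul_sum]
      simp [T]
      ring
    · intro b hb
      have : T (a+1) (a+1+1+b) = 0 := T_gt (by omega)
      rw [this, h2]; simp
  · subst h
    rw [if_neg (by omega), if_pos (by omega), zero_add, mul_sum]
    exact sum_congr rfl fun b hb => by simp [T, mem_range.1 hb]
  · rw [if_neg (by omega), if_neg (by omega)]
    symm
    simp only [mul_zero, add_zero]
    apply sum_eq_zero
    intro b hb
    have hb := mem_range.1 hb
    have : b < a + 1 := by omega
    simp [T, h, this]

lemma PS_congr (j hs A) (φ ψ : List ℕ → ℚ[X]) (h : ∀ ks, φ ks = ψ ks) : PS j hs A φ = PS j hs A ψ := by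
  rw [show φ = ψ from funext h]

lemma claimA_nil {s : ℕ} (A : ℕ) (c : Fin s → ℕ → ℚ[X]) :
    Dt (fun i => ∑ b ∈ range A, c i b • (fun j : Fin (s+1) => W (j+1) [] b)) (fun j => W (j+1) [] A)
    = PS (s+1) [] A (fun ks => Matrix.det (Matrix.of fun i j : Fin s => ∑ b ∈ range A, c i b * DW (j+1) ks b)) := by
  rcases lt_trichotomy A (s+1) with h | h | h
  · have : PS (s+1) [] A (fun ks => Matrix.det (Matrix.of fun i j : Fin s => ∑ b ∈ range A, c i b * DW (j+1) ks b)) = 0 := by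
      simp [PS, LP, h.ne]
    rw [this]
    apply Matrix.det_eq_zero_of_column_eq_zero (Fin.last s)
    intro i
    refine Fin.lastCases ?_ (fun i => ?_) i
    · simp [W_nil, h.ne]
    · simp only [Matrix.of_apply, Fin.snoc_castSucc, Finset.sum_apply, Pi.smul_apply, W_nil, Fin.val_last]
      apply sum_eq_zero
      intro b hb
      have := mem_range.1 hb
      rw [if_neg (by omega)]; simp
  · subst h
    have hR : PS (s+1) [] (s+1) (fun ks => Matrix.det (Matrix.of fun i j : Fin s => ∑ b ∈ range (s+1), c i b * DW (j+1) ks b)) 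
       = Matrix.det (Matrix.of fun i j : Fin s => ∑ b ∈ range (s+1), c i b * DW (j+1) [] b) := by
      simp [PS, LP, ex]
    rw [hR]
    have hfac : (Matrix.of fun i j : Fin s => ∑ b ∈ range (s+1), c i b * DW (j+1) [] b) = 
       (Matrix.of fun i j : Fin s => c i (j+1)) * (Matrix.of fun k j : Fin s => DW (j+1) [] (k+1)) := by
      ext1 i j
      rw [Matrix.mul_apply, Matrix.of_apply, sum_range_succ', DW_zero _ (by omega), mul_zero, add_zero]
      rw [Finset.sum_range]
      rfl
    have htri : Matrix.det (Matrix.of fun k j : Fin s => DW (j+1) [] (k+1)) = 1 := by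
      rw [Matrix.det_of_isLowerTriangular]
      · apply prod_eq_one
        intro i _
        simp [DW, W_nil]
      · intro i j hij
        have : i < j := hij
        simp [DW, W_nil]
        rw [if_neg (by omega), if_neg (by omega)]; simp
    rw [hfac, Matrix.det_mul, htri, mul_one]
    unfold Dt
    rw [Matrix.det_succ_row _ (Fin.last s), Finset.sum_eq_single (Fin.last s)]
    · simp only [Matrix.of_apply, Fin.snoc_last, W_nil]
      simp
      congr 1
      ext1 i j
      simp only [Matrix.submatrix_apply, Matrix.of_apply, Fin.snoc_castSucc, Finset.sum_apply, Pi.smul_apply, Fin.val_castSucc, smul_eq_mul, mul_ite, mul_one, mul_zero]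
      rw [Finset.sum_ite_eq' ]
      simp
    · intro j _ hj
      have : (j : ℕ) ≠ s := fun h => hj (Fin.ext h)
      simp [W_nil]
      intro h; omega
    · simp
  · have : PS (s+1) [] A (fun ks => Matrix.det (Matrix.of fun i j : Fin s => ∑ b ∈ range A, c i b * DW (j+1) ks b)) = 0 := by
      simp [PS, LP, h.ne']
    rw [this]
    have : (fun j : Fin (s+1) => W (j+1) [] A) = 0 := by
      ext1 j
      rw [W_nil, if_neg (by omega)]; rfl
    rw [this, Dt_zero]

lemma claimA {s : ℕ} (hs : List ℕ) (A : ℕ) (c : Fin s → ℕ → ℚ[X]) :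
    Dt (fun i => ∑ b ∈ range A, c i b • (fun j : Fin (s+1) => W (j+1) hs b)) (fun j => W (j+1) hs A)
    = PS (s+1) hs A (fun ks => Matrix.det (Matrix.of fun i j : Fin s => ∑ b ∈ range A, c i b * DW (j+1) ks b)) := by
  induction hs generalizing A c with
  | nil => exact claimA_nil A c
  | cons H hs ih =>
    by_cases hA : A ≤ H
    swap
    · rw [PS_cons_big _ _ _ _ _ hA]
      have : (fun j : Fin (s+1) => W (j+1) (H::hs) A) = 0 := by
        ext1 j
        rw [W_cons _ (by omega), if_neg hA]; rfl
      rw [this, Dt_zero]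
    rw [PS_cons _ (by omega) _ _ _ _ hA]
    have hrow : ∀ a ≤ A, (fun j : Fin (s+1) => W (j+1) (H::hs) a) = 
        ∑ b ∈ range (A+1), T a b • (fun j : Fin (s+1) => W (j+1) hs b) := by
      intro a ha
      ext1 j
      rw [W_cons _ (by omega), if_pos (by omega)]
      simp only [Finset.sum_apply, Pi.smul_apply, smul_eq_mul]
      refine sum_subset (by intro x; simp; omega) ?_
      intro b hb hb'
      have : T a b = 0 := T_gt (by simp at hb hb'; omega)
      simp [this]
    rw [hrow A le_rfl]
    have hrows : (fun i => ∑ b ∈ range A, c i b • (fun j : Fin (s+1) => W (j+1) (H::hs) b)) =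
        fun i => ∑ b ∈ range (A+1), (∑ a ∈ range A, c i a * T a b) • (fun j : Fin (s+1) => W (j+1) hs b) := by
      ext1 i
      rw [sum_congr rfl fun b hb => by rw [hrow b (mem_range.1 hb).le]]
      simp only [smul_sum, sum_smul, mul_smul]
      rw [sum_comm]
    rw [hrows, tele (A+1) (fun i b => ∑ a ∈ range A, c i a * T a b)]
    · refine sum_congr rfl fun K hK => ?_
      congr 1
      rw [ih K (fun i b => (∑ a ∈ range A, c i a * T a b) - ∑ a ∈ range A, c i a * T a K)]
      rcases Nat.eq_zero_or_pos K with rfl | hK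
      · rw [PS_zero _ (by omega), PS_zero _ (by omega)]
      apply PS_congr
      intro ks
      congr 1
      ext1 i j
      simp only [Matrix.of_apply, DW_cons _ (show 1 ≤ (j : ℕ)+1 by omega) K hK, mul_sum, ← sum_sub_distrib, sum_mul]
      rw [sum_comm]
      refine sum_congr rfl fun a _ => sum_congr rfl fun b _ => by ring
    · intro K hK
      rcases Nat.lt_or_ge K A with h | h
      · right; intro b hb
        simp [T, h, hb.trans h]
      · left; intro i
        apply sum_eq_zero
        intro a ha
        have : T a K = 0 := by
          have := mem_range.1 ha
          exact T_gt (by omega)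
        rw [this, mul_zero]

noncomputable def NN (n r : ℕ) (hs : List ℕ) : ℚ[X] :=
  Matrix.det (Matrix.of fun i j : Fin r =>
    ∑ a ∈ range (n+1), ((n - a + r).choose (r - 1 - i) : ℚ[X]) * W (j+1) hs a)

lemma hockey (n c k K : ℕ) (hK : K ≤ n) (b : ℕ) (hb : b ≤ K) :
    ∑ a ∈ Ico b K, ((n - a + c).choose k : ℚ[X]) = ((n - b + (c+1)).choose (k+1) : ℚ[X]) - ((n - K + (c+1)).choose (k+1) : ℚ[X]) := by
  induction K with
  | zero => have : b = 0 := by omega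
            subst this; simp
  | succ K ih =>
    rcases hb.lt_or_eq with h | h
    · rw [sum_Ico_succ_top (by omega), ih (by omega) (by omega)]
      rw [show n - K + (c+1) = (n-K+c)+1 by omega, show n - (K+1) + (c+1) = n - K + c by omega, Nat.choose_succ_succ]
      push_cast; ring
    · subst h; simp

lemma NN_succ (n s : ℕ) (hs : List ℕ) :
    NN n (s+1) hs = ∑ K ∈ range (n+1), PS (s+1) hs K (fun ks => NN n s ((K-1) :: ks)) := by
  have h1 : NN n (s+1) hs = Dt (fun i : Fin s => ∑ b ∈ range (n+1), ((n - b + (s+1)).choose (s - i) : ℚ[X]) • (fun j : Fin (s+1) => W (j+1) hs b)) (∑ b ∈ range (n+1), (1 : ℚ[X]) • (fun j : Fin (s+1) => W (j+1) hs b)) := by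
    unfold NN Dt
    congr 1
    ext1 i j
    refine Fin.lastCases ?_ (fun i => ?_) i
    · simp
    · simp
  rw [h1, tele (n+1) (fun (i : Fin s) b => ((n - b + (s+1)).choose (s - i) : ℚ[X])) (fun _ => 1) (fun b (j : Fin (s+1)) => W (j+1) hs b)]
  · refine sum_congr rfl fun K hK => ?_
    have hKn : K ≤ n := by have := mem_range.1 hK; omega
    rw [one_mul, claimA hs K (fun (i : Fin s) b => ((n - b + (s+1)).choose (s - i) : ℚ[X]) - ((n - K + (s+1)).choose (s - i) : ℚ[X]))]
    rcases Nat.eq_zero_or_pos K with rfl | hK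
    · rw [PS_zero _ (by omega), PS_zero _ (by omega)]
    apply PS_congr
    intro ks
    unfold NN
    congr 1
    ext1 i j
    simp only [Matrix.of_apply]
    have e1 : ∑ a ∈ range (n+1), ((n - a + s).choose (s - 1 - i) : ℚ[X]) * W (j+1) ((K-1)::ks) a = 
        ∑ a ∈ range K, ∑ b ∈ range (a+1), ((n - a + s).choose (s - 1 - i) : ℚ[X]) * DW (j+1) ks b := by
      rw [← sum_subset (s₁ := range K) (s₂ := range (n+1)) (by intro x hx; simp at hx ⊢; omega)]
      · refine sum_congr rfl fun a ha => ?_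
        have := mem_range.1 ha
        rw [W_cons' _ (by omega), if_pos (by omega), mul_sum]
      · intro a ha ha'
        simp at ha'
        rw [W_cons' _ (by omega), if_neg (by omega), mul_zero]
    rw [e1]
    rw [Finset.sum_comm' (t' := range K) (s' := fun b => Ico b K) (by intro x y; simp; omega)]
    refine sum_congr rfl fun b hb => ?_
    rw [← sum_mul, hockey n s (s-1-i) K hKn b (mem_range.1 hb).le, show s - 1 - (i:ℕ) + 1 = s - i by omega]
  · intro K _; right; intros; rfl

lemma rowT (n c k a : ℕ) (ha : a ≤ n) :
    ∑ b ∈ Icc a n, ((n - b + c).choose k : ℚ[X]) * T b a =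
      X * ((n - a + c).choose (k+1) : ℚ[X]) + ((n - a + c).choose k : ℚ[X]) - X * (c.choose (k+1) : ℚ[X]) := by
  have e0 : ∀ b ∈ Icc a n, True := fun _ _ => trivial
  rw [show Icc a n = Ico a (n+1) by ext; simp; try omega, sum_eq_sum_Ico_succ_bot (by omega)]
  have h1 : ∑ b ∈ Ico (a+1) (n+1), ((n - b + c).choose k : ℚ[X]) * T b a = X * ∑ b ∈ Ico (a+1) (n+1), ((n - b + c).choose k : ℚ[X]) := by
    rw [mul_sum]
    refine sum_congr rfl fun b hb => ?_
    have : a < b := by simp at hb; omega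
    simp [T, this, mul_comm]
  rw [h1]
  rcases ha.lt_or_eq with h | h
  · rw [sum_Ico_succ_top (by omega), hockey n c k n le_rfl (a+1) (by omega), show n - (a+1) + (c+1) = n - a + c by omega]
    simp [T, Nat.choose_succ_succ c k]
    ring
  · subst h
    simp [T]

lemma Q_cons (n c l j : ℕ) (hj : 1 ≤ j) (hs : List ℕ) :
    ∑ a ∈ range (n+1), ((n - a + c).choose l : ℚ[X]) * W j (n :: hs) a =
      X * ∑ a ∈ range (n+1), ((n - a + c).choose (l+1) : ℚ[X]) * W j hs a
      + ∑ a ∈ range (n+1), ((n - a + c).choose l : ℚ[X]) * W j hs a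
      - X * (c.choose (l+1) : ℚ[X]) * ∑ a ∈ range (n+1), ((n - a + c).choose 0 : ℚ[X]) * W j hs a := by
  have e1 : ∑ a ∈ range (n+1), ((n - a + c).choose l : ℚ[X]) * W j (n :: hs) a = 
      ∑ a ∈ range (n+1), ∑ b ∈ range (a+1), ((n - a + c).choose l : ℚ[X]) * T a b * W j hs b := by
    refine sum_congr rfl fun a ha => ?_
    have := mem_range.1 ha
    rw [W_cons j hj, if_pos (by omega), mul_sum]
    refine sum_congr rfl fun b _ => by ring
  rw [e1, Finset.sum_comm' (t' := range (n+1)) (s' := fun b => Icc b n) (by intro x y; simp; omega)]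
  rw [mul_sum, mul_sum, ← sum_add_distrib, ← sum_sub_distrib]
  refine sum_congr rfl fun b hb => ?_
  rw [← sum_mul, rowT n c l b (by have := mem_range.1 hb; omega)]
  simp
  ring

lemma rows (n c k : ℕ) : ∃ p : ℕ → ℚ[X], p k = X ^ k ∧ (∀ l, k < l → p l = 0) ∧
    ∀ j, 1 ≤ j → ∀ hs, ∀ N, k < N → ∑ a ∈ range (n+1), W j (List.replicate k n ++ hs) a =
      ∑ l ∈ range N, p l * ∑ a ∈ range (n+1), ((n - a + c).choose l : ℚ[X]) * W j hs a := by
  induction k with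
  | zero =>
    refine ⟨fun l => if l = 0 then 1 else 0, by simp, fun l hl => by simp; omega, ?_⟩
    intro j hj hs N hN
    simp [hN]
  | succ k ih =>
    obtain ⟨p, p1, p2, p3⟩ := ih
    refine ⟨fun l => (if l = 0 then - ∑ i ∈ range (k+1), p i * (X * (c.choose (i+1) : ℚ[X])) else X * p (l-1)) + p l, ?_, ?_, ?_⟩
    · simp [p1, p2]; ring
    · intro l hl
      simp only [p2 l (by omega), p2 (l-1) (by omega)]
      rw [if_neg (by omega)]; simp
    · intro j hj hs N hN
      obtain ⟨N, rfl⟩ : ∃ M, N = M + 1 := ⟨N-1, by omega⟩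
      rw [show List.replicate (k+1) n ++ hs = List.replicate k n ++ (n :: hs) by
        rw [List.replicate_succ']; simp]
      rw [p3 j hj (n::hs) (k+1) (by omega)]
      simp only [Q_cons n c _ j hj hs]
      set Q : ℕ → ℚ[X] := fun l => ∑ a ∈ range (n+1), ((n - a + c).choose l : ℚ[X]) * W j hs a with hQ
      change ∑ x ∈ range (k+1), p x * (X * Q (x+1) + Q x - X * _ * Q 0) = ∑ l ∈ range (N+1), _ * Q l
      have hp : ∀ f : ℕ → ℚ[X], ∀ M, k < M → ∑ l ∈ range M, p l * f l = ∑ l ∈ range (k+1), p l * f l := by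
        intro f M hM
        symm
        refine sum_subset (fun x hx => by simp at hx ⊢; omega) ?_
        intro x _ hx
        rw [p2 x (by simpa using hx), zero_mul]
      simp only [add_mul, sum_add_distrib]
      rw [hp _ (N+1) (by omega), sum_range_succ' _ N]
      simp only [Nat.add_sub_cancel, if_true, Nat.succ_ne_zero, if_false]
      have := hp (fun l => X * Q (l+1)) N (by omega)
      have e : ∑ x ∈ range N, X * p x * Q (x+1) = ∑ l ∈ range (k+1), p l * (X * Q (l+1)) := by
        rw [← this]; exact sum_congr rfl fun x _ => by ring
      rw [e, neg_mul, sum_mul, ← sum_neg_distrib, ← sum_add_distrib, ← sum_add_distrib]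
      exact sum_congr rfl fun x _ => by ring

lemma det_rows (n r : ℕ) (hs : List ℕ) :
    Matrix.det (Matrix.of fun i j : Fin r =>
      ∑ a ∈ range (n+1), W (j+1) (List.replicate (r-1-i) n ++ hs) a) = X ^ r.choose 2 * NN n r hs := by
  choose p p1 p2 p3 using rows n r
  have hfac : (Matrix.of fun i j : Fin r =>
      ∑ a ∈ range (n+1), W (j+1) (List.replicate (r-1-i) n ++ hs) a) = 
      (Matrix.of fun i l : Fin r => p (r-1-i) (r-1-l)) * (Matrix.of fun i j : Fin r =>
    ∑ a ∈ range (n+1), ((n - a + r).choose (r - 1 - i) : ℚ[X]) * W (j+1) hs a) := by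
    ext1 i j
    rw [Matrix.mul_apply, Matrix.of_apply, p3 _ (j+1) (by omega) hs r (by omega)]
    rw [← Finset.sum_range_reflect, Finset.sum_range]
    rfl
  rw [hfac, Matrix.det_mul]
  unfold NN
  congr 1
  rw [Matrix.det_of_isUpperTriangular]
  · simp only [Matrix.of_apply, p1]
    rw [Finset.prod_pow_eq_pow_sum]
    congr 1
    have := Finset.sum_range_reflect (fun i => i) r
    rw [← Finset.sum_range (fun i => r - 1 - i), this, Finset.sum_range_id, Nat.choose_two_right]
  · intro i l hil
    have : l < i := hil
    simp only [Matrix.of_apply]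
    apply p2
    omega


def toSet : ℕ → ℕ → List ℕ → Finset (ℕ × ℕ)
  | _, _, [] => ∅
  | x, A, K :: ks => ({x} ×ˢ Icc K A) ∪ toSet (x+1) K ks

def hts (h : ℕ → ℕ) : ℕ → ℕ → List ℕ
  | _, 0 => []
  | x, d+1 => h x :: hts h (x+1) d

lemma toSet_nil (x A : ℕ) : toSet x A [] = ∅ := rfl

lemma mem_toSet_cons (x A K : ℕ) (ks : List ℕ) (p : ℕ × ℕ) :
    p ∈ toSet x A (K :: ks) ↔ (p.1 = x ∧ K ≤ p.2 ∧ p.2 ≤ A) ∨ p ∈ toSet (x+1) K ks := by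
  simp only [toSet, Finset.mem_union, Finset.mem_product, Finset.mem_singleton, mem_Icc]

lemma toSet_bd {j : ℕ} {hs : List ℕ} {x A : ℕ} {ks : List ℕ} (hv : Val j hs A ks) {p : ℕ × ℕ}
    (hp : p ∈ toSet x A ks) : x ≤ p.1 ∧ 1 ≤ p.2 ∧ p.2 ≤ A := by
  induction hs generalizing x A ks with
  | nil => cases ks <;> simp_all [Val, toSet]
  | cons H hs ih =>
    cases ks with
    | nil => simp [toSet] at hp
    | cons K ks =>
      obtain ⟨h1, h2, h3, h4⟩ := hv
      rcases (mem_toSet_cons _ _ _ _ _).1 hp with h | h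
      · omega
      · have := ih h4 h
        omega

lemma toSet_inj {j : ℕ} {hs : List ℕ} {x A : ℕ} {ks ls : List ℕ} (hv : Val j hs A ks) (hl : Val j hs A ls)
    (he : toSet x A ks = toSet x A ls) : ks = ls := by
  induction hs generalizing x A ks ls with
  | nil => cases ks <;> cases ls <;> simp_all [Val]
  | cons H hs ih =>
    cases ks with
    | nil => simp [Val] at hv
    | cons K ks =>
    cases ls with
    | nil => simp [Val] at hl
    | cons L ls =>
      obtain ⟨h1, h2, h3, h4⟩ := hv
      obtain ⟨l1, l2, l3, l4⟩ := hl
      have hm : ∀ p, p ∈ toSet x A (K :: ks) ↔ p ∈ toSet x A (L :: ls) := fun p => by rw [he]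
      simp only [mem_toSet_cons] at hm
      have b1 : ∀ p, p ∈ toSet (x+1) K ks → x + 1 ≤ p.1 := fun p hp => (toSet_bd h4 hp).1
      have b2 : ∀ p, p ∈ toSet (x+1) L ls → x + 1 ≤ p.1 := fun p hp => (toSet_bd l4 hp).1
      have hKL : K = L := by
        have e1 : L ≤ K := by
          rcases (hm (x, K)).1 (Or.inl ⟨rfl, le_rfl, h3⟩) with h | h
          · exact h.2.1
          · have := b2 _ h; simp at this
        have e2 : K ≤ L := by
          rcases (hm (x, L)).2 (Or.inl ⟨rfl, le_rfl, l3⟩) with h | h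
          · exact h.2.1
          · have := b1 _ h; simp at this
        omega
      subst hKL
      rw [ih h4 l4]
      ext p
      constructor
      · intro hp
        rcases (hm p).1 (Or.inr hp) with h | h
        · have := b1 p hp; omega
        · exact h
      · intro hp
        rcases (hm p).2 (Or.inr hp) with h | h
        · have := b2 p hp; omega
        · exact h

lemma isPath_base (n : ℕ) (h : ℕ → ℕ) (j m A : ℕ) (hj : 1 ≤ j) (hm : 1 ≤ m) (hA : A ≤ n) (C : Finset (ℕ × ℕ)) :
    IsPath (ladder m n h) (m, A) (m, j) C ↔ ∃ ks, Val j [h m] A ks ∧ C = toSet m A ks := by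
  constructor
  · rintro ⟨hY, hPC, hQC, hb, hc, hmax⟩
    refine ⟨[j], ?_, ?_⟩
    · have h1 : 1 ≤ m ∧ m ≤ m ∧ 1 ≤ A ∧ A ≤ n ∧ A ≤ h m := hY hPC
      have h2 := hb _ hPC
      simp only [ple] at h2
      exact ⟨by omega, hj, by omega, rfl⟩
    · ext ⟨a, b⟩
      simp only [mem_toSet_cons, toSet_nil]
      constructor
      · intro hp
        have := hb _ hp
        simp only [ple] at this
        left; omega
      · rintro (⟨h1, h2, h3⟩ | h1)
        · subst h1
          apply hmax
          · have h1 := hY hPC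
            simp only [ladder, Set.mem_ofPred_eq] at h1 ⊢
            omega
          · simp only [ple]; omega
          · simp only [ple]; omega
          · rintro ⟨c, d⟩ hp
            have := hb _ hp
            simp only [ple] at this ⊢
            omega
        · simp at h1
  · rintro ⟨ks, hv, rfl⟩
    match ks, hv with
    | [K], hv =>
      obtain ⟨h1, h2, h3, h4⟩ := hv
      simp only [Val] at h4
      subst h4
      have hm' : ∀ p : ℕ × ℕ, p ∈ toSet m A [K] ↔ (p.1 = m ∧ K ≤ p.2 ∧ p.2 ≤ A) := by
        intro p; simp only [mem_toSet_cons, toSet_nil, Finset.notMem_empty, or_false]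
      refine ⟨?_, ?_, ?_, ?_, ?_, ?_⟩
      · intro p hp
        have := (hm' p).1 hp
        simp only [ladder, Set.mem_ofPred_eq]
        rw [this.1]
        omega
      · rw [hm']; simp; omega
      · rw [hm']; simp; omega
      · intro p hp
        have := (hm' p).1 hp
        simp only [ple]; omega
      · intro p hp q hq
        have := (hm' p).1 hp
        have := (hm' q).1 hq
        simp only [ple]; omega
      · intro z _ h1 h2 _
        simp only [ple] at h1 h2
        rw [hm']; omega
    | [], hv => simp [Val] at hv
    | _ :: _ :: _, hv => simp [Val] at hv

lemma isPath_step_fwd (n : ℕ) (h : ℕ → ℕ) (hanti : Antitone h) (j m x A : ℕ) (hx : 1 ≤ x)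
    (hxm : x < m) (C : Finset (ℕ × ℕ)) (hp : IsPath (ladder m n h) (x, A) (m, j) C) :
    ∃ K C', A ≤ h x ∧ 1 ≤ K ∧ K ≤ A ∧ IsPath (ladder m n h) (x+1, K) (m, j) C' ∧
      C = ({x} ×ˢ Icc K A) ∪ C' := by
  obtain ⟨hY, hPC, hQC, hb, hc, hmax⟩ := hp
  let C' := C.filter (fun p => x + 1 ≤ p.1)
  have hC' : ∀ p, p ∈ C' ↔ p ∈ C ∧ x + 1 ≤ p.1 := fun p => by simp [C']
  have hQ' : (m, j) ∈ C' := by rw [hC']; exact ⟨hQC, hxm⟩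
  obtain ⟨⟨x', K⟩, hq, hqmax⟩ := C'.exists_max_image (fun p => p.2) ⟨_, hQ'⟩
  simp only at hqmax
  have hq' := (hC' _).1 hq
  have yA := hY hPC
  have yq := hY hq'.1
  have bq := hb _ hq'.1
  have hanti' := hanti hq'.2
  simp only [ladder, Set.mem_ofPred_eq] at yA yq
  simp only [ple] at bq hanti' hq'
  have colx : ∀ y, (x, y) ∈ C → K ≤ y := by
    intro y hy
    have := hc _ hy _ hq'.1
    simp only [ple] at this
    omega
  have hfull : ∀ y, K ≤ y → y ≤ A → (x, y) ∈ C := by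
    intro y h1 h2
    apply hmax
    · simp only [ladder, Set.mem_ofPred_eq]; omega
    · simp only [ple]; omega
    · simp only [ple]; omega
    · rintro ⟨c, d⟩ hcd
      have b1 := hb _ hcd
      by_cases hcx : x + 1 ≤ c
      · have := hqmax _ ((hC' _).2 ⟨hcd, hcx⟩)
        simp only [ple] at b1 this ⊢
        omega
      · simp only [ple] at b1 ⊢
        omega
  have hcor : (x+1, K) ∈ C := by
    apply hmax
    · simp only [ladder, Set.mem_ofPred_eq]; omega
    · simp only [ple]; omega
    · simp only [ple]; omega
    · rintro ⟨c, d⟩ hcd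
      have b1 := hb _ hcd
      by_cases hcx : x + 1 ≤ c
      · have := hqmax _ ((hC' _).2 ⟨hcd, hcx⟩)
        simp only [ple] at b1 this ⊢
        omega
      · simp only [ple] at b1 ⊢
        have : c = x := by omega
        subst this
        have := colx _ hcd
        omega
  refine ⟨K, C', yA.2.2.2.2, yq.2.2.1, by omega, ⟨?_, ?_, hQ', ?_, ?_, ?_⟩, ?_⟩
  · intro p hp
    exact hY ((hC' p).1 hp).1
  · rw [hC']; exact ⟨hcor, le_rfl⟩
  · intro p hp
    have h1 := hb _ ((hC' p).1 hp).1
    have h2 := hqmax _ hp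
    have h3 := ((hC' p).1 hp).2
    simp only [ple] at h1 ⊢
    omega
  · intro p hp q hq
    exact hc _ ((hC' p).1 hp).1 _ ((hC' q).1 hq).1
  · rintro ⟨a, b⟩ hz h1 h2 h3
    rw [hC']
    simp only [ple] at h1 h2
    refine ⟨?_, h2.1⟩
    apply hmax _ hz
    · exact h1
    · simp only [ple]; omega
    · rintro ⟨c, d⟩ hcd
      by_cases hcx : x + 1 ≤ c
      · exact h3 _ ((hC' _).2 ⟨hcd, hcx⟩)
      · have b1 := hb _ hcd
        simp only [ple] at b1 ⊢
        have : c = x := by omega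
        subst this
        have := colx _ hcd
        omega
  · ext ⟨a, b⟩
    simp only [Finset.mem_union, Finset.mem_product, Finset.mem_singleton, mem_Icc, hC']
    constructor
    · intro hp
      have b1 := hb _ hp
      simp only [ple] at b1
      by_cases hcx : x + 1 ≤ a
      · right; exact ⟨hp, hcx⟩
      · left
        have : a = x := by omega
        subst this
        have := colx _ hp
        omega
    · rintro (⟨rfl, h1, h2⟩ | h1)
      · exact hfull _ h1 h2
      · exact h1.1

lemma isPath_step_bwd (n : ℕ) (h : ℕ → ℕ) (j m x A : ℕ) (hx : 1 ≤ x)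
    (hxm : x < m) (hA : A ≤ n) (K : ℕ) (C' : Finset (ℕ × ℕ)) (h1 : A ≤ h x) (h2 : 1 ≤ K) (h3 : K ≤ A)
    (hp : IsPath (ladder m n h) (x+1, K) (m, j) C') :
    IsPath (ladder m n h) (x, A) (m, j) (({x} ×ˢ Icc K A) ∪ C') := by
  obtain ⟨hY, hPC, hQC, hb, hc, hmax⟩ := hp
  have bq := hb _ hPC
  simp only [ple] at bq
  have hm : ∀ p : ℕ × ℕ, p ∈ (({x} ×ˢ Icc K A) ∪ C') ↔ (p.1 = x ∧ K ≤ p.2 ∧ p.2 ≤ A) ∨ p ∈ C' := by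
    intro p; simp only [Finset.mem_union, Finset.mem_product, Finset.mem_singleton, mem_Icc]
  refine ⟨?_, ?_, ?_, ?_, ?_, ?_⟩
  · intro p hp
    rcases (hm p).1 hp with h | h
    · simp only [ladder, Set.mem_ofPred_eq]
      rw [h.1]
      omega
    · exact hY h
  · rw [hm]; left; simp; omega
  · rw [hm]; right; exact hQC
  · intro p hp
    rcases (hm p).1 hp with h | h
    · simp only [ple]; omega
    · have := hb _ h
      simp only [ple] at this ⊢; omega
  · intro p hp q hq
    rcases (hm p).1 hp with h | h <;> rcases (hm q).1 hq with h' | h'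
    · simp only [ple]; omega
    · have := hb _ h'
      simp only [ple] at this ⊢; omega
    · have := hb _ h
      simp only [ple] at this ⊢; omega
    · exact hc _ h _ h'
  · rintro ⟨a, b⟩ hz z1 z2 z3
    rw [hm]
    have c1 := z3 (x+1, K) ((hm _).2 (Or.inr hPC))
    have c2 := z3 (x, K) ((hm _).2 (Or.inl ⟨rfl, le_rfl, h3⟩))
    simp only [ple] at z1 z2 c1 c2
    by_cases hax : a = x
    · left; simp only; omega
    · right
      apply hmax _ hz
      · exact z1
      · simp only [ple]; omega
      · intro p hp
        exact z3 p ((hm p).2 (Or.inr hp))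

lemma isPath_iff (n : ℕ) (h : ℕ → ℕ) (hanti : Antitone h) (j m d x A : ℕ) (hj : 1 ≤ j) (hx : 1 ≤ x)
    (hm : m = x + d) (hA : A ≤ n) (C : Finset (ℕ × ℕ)) :
    IsPath (ladder m n h) (x, A) (m, j) C ↔ ∃ ks, Val j (hts h x (d+1)) A ks ∧ C = toSet x A ks := by
  induction d generalizing x A C with
  | zero =>
    have : m = x := by omega
    subst this
    exact isPath_base n h j m A hj hx hA C
  | succ d ih =>
    constructor
    · intro hp
      obtain ⟨K, C', h1, h2, h3, h4, h5⟩ := isPath_step_fwd n h hanti j m x A hx (by omega) C hp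
      obtain ⟨ks, h6, h7⟩ := (ih (x+1) K (by omega) (by omega) (by omega) C').1 h4
      exact ⟨K :: ks, ⟨h1, h2, h3, h6⟩, by rw [h5, h7]; rfl⟩
    · rintro ⟨ks, hv, rfl⟩
      cases ks with
      | nil => simp [hts, Val] at hv
      | cons K ks =>
        obtain ⟨h1, h2, h3, h4⟩ := hv
        exact isPath_step_bwd n h j m x A hx (by omega) hA K _ h1 h2 h3
          ((ih (x+1) K (by omega) (by omega) (by omega) _).2 ⟨ks, h4, rfl⟩)

def exx : List ℕ → ℕ
  | [] => 0
  | K :: ks => ex K ks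

lemma corners_eq {j : ℕ} {hs : List ℕ} {x A : ℕ} {ks : List ℕ} (hx : 1 ≤ x) (hv : Val j hs A ks) :
    cornersCount (toSet x A ks) = exx ks := by
  induction hs generalizing x A ks with
  | nil => cases ks <;> simp_all [Val, toSet, exx, cornersCount]
  | cons H hs ih =>
    match ks, hv with
    | [], hv => simp [Val] at hv
    | [K], hv =>
      simp only [exx, ex, cornersCount, Finset.card_eq_zero, Finset.filter_eq_empty_iff]
      intro p hp
      simp only [mem_toSet_cons, toSet_nil, Finset.notMem_empty, or_false] at hp ⊢
      omega
    | K :: K2 :: ks, hv =>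
      obtain ⟨h1, h2, h3, h4⟩ := hv
      have IH := ih (x := x+1) (by omega) h4
      match hs, h4 with
      | [], h4 => simp [Val] at h4
      | H2 :: hs, h4 =>
      obtain ⟨g1, g2, g3, g4⟩ := h4
      have b : ∀ p ∈ toSet (x+1+1) K2 ks, x + 1 + 1 ≤ p.1 ∧ 1 ≤ p.2 ∧ p.2 ≤ K2 := fun p hp => toSet_bd g4 hp
      simp only [exx, ex] at IH ⊢
      rw [← IH]
      unfold cornersCount
      split_ifs with hlt
      · rw [add_comm, ← Finset.card_insert_of_notMem (a := (x+1, K))]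
        · congr 1
          ext ⟨a, c⟩
          have b1 := b (a, c)
          have b2 := b (a-1, c)
          have b3 := b (a, c-1)
          simp only [Finset.mem_insert, Finset.mem_filter, mem_toSet_cons, Prod.mk.injEq] at b1 b2 b3 ⊢
          by_cases q1 : (a, c) ∈ toSet (x+1+1) K2 ks <;> by_cases q2 : (a-1, c) ∈ toSet (x+1+1) K2 ks <;>
            by_cases q3 : (a, c-1) ∈ toSet (x+1+1) K2 ks <;> simp only [q1, q2, q3, true_imp_iff, false_imp_iff, or_true, or_false, true_and, and_true] at b1 b2 b3 ⊢ <;> omega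
        · have b2 := b (x, K)
          simp only [Finset.mem_filter, mem_toSet_cons, Nat.add_sub_cancel] at b2 ⊢
          by_cases q2 : (x, K) ∈ toSet (x+1+1) K2 ks
          · have := b2 q2; omega
          · simp [q2]
      · rw [zero_add]
        congr 1
        ext ⟨a, c⟩
        have b1 := b (a, c)
        have b2 := b (a-1, c)
        have b3 := b (a, c-1)
        simp only [Finset.mem_filter, mem_toSet_cons] at b1 b2 b3 ⊢
        by_cases q1 : (a, c) ∈ toSet (x+1+1) K2 ks <;> by_cases q2 : (a-1, c) ∈ toSet (x+1+1) K2 ks <;>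
            by_cases q3 : (a, c-1) ∈ toSet (x+1+1) K2 ks <;> simp only [q1, q2, q3, true_imp_iff, false_imp_iff, or_true, or_false, true_and, and_true] at b1 b2 b3 ⊢ <;> omega

lemma ex_le (A : ℕ) (ks : List ℕ) : ex A ks ≤ ks.length := by
  induction ks generalizing A with
  | nil => simp [ex]
  | cons K ks ih =>
    have := ih K
    simp only [ex, List.length_cons]
    split_ifs <;> omega

lemma exx_le (ks : List ℕ) : exx ks ≤ ks.length := by
  cases ks with
  | nil => simp [exx]
  | cons K ks => have := ex_le K ks; simp [exx]; omega

lemma Val_length {j : ℕ} {hs : List ℕ} {A : ℕ} {ks : List ℕ} (hv : Val j hs A ks) : ks.length = hs.length := by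
  induction hs generalizing A ks with
  | nil => cases ks <;> simp_all [Val]
  | cons H hs ih =>
    cases ks with
    | nil => simp [Val] at hv
    | cons K ks => simp [ih hv.2.2.2]

lemma genf {α β : Type*} [DecidableEq β] (S : Finset α) (f : α → β) (hinj : Set.InjOn f S) (w : β → ℕ) (N : ℕ)
    (hN : ∀ a ∈ S, w (f a) < N) (P : β → Prop) (hP : ∀ b, P b ↔ ∃ a ∈ S, f a = b) :
    ∑ k ∈ range N, (Set.ncard {b | P b ∧ w b = k} : ℚ[X]) * X ^ k = ∑ a ∈ S, X ^ w (f a) := by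
  have h1 : ∀ k, Set.ncard {b | P b ∧ w b = k} = (S.filter (fun a => w (f a) = k)).card := by
    intro k
    rw [← Finset.card_image_of_injOn (f := f) (hinj.mono (by intro a; simp; tauto)), ← Set.ncard_coe_finset]
    congr 1
    ext b
    simp only [Set.mem_ofPred_eq, hP, Finset.coe_image, Set.mem_image, Finset.mem_coe, Finset.mem_filter]
    constructor
    · rintro ⟨⟨a, ha, rfl⟩, hk⟩
      exact ⟨a, ⟨ha, hk⟩, rfl⟩
    · rintro ⟨a, ⟨ha, hk⟩, rfl⟩
      exact ⟨⟨a, ha, rfl⟩, hk⟩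
  simp only [h1]
  rw [← Finset.sum_fiberwise_of_maps_to (s := S) (t := range N) (g := fun a => w (f a)) (fun a ha => mem_range.2 (hN a ha))]
  refine sum_congr rfl fun k _ => ?_
  rw [sum_congr rfl (g := fun _ => (X : ℚ[X]) ^ k) (fun a ha => by rw [(Finset.mem_filter.1 ha).2])]
  simp


lemma planar0 {J j : ℕ} {hs : List ℕ} {x A A' : ℕ} {ks l : List ℕ} (hv : Val J hs A ks) (hA : A' ≤ A) :
    (Val j hs A' l ∧ Disjoint (toSet x A' l) (toSet x A ks)) ↔ Val j (ks.map Nat.pred) A' l := by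
  induction hs generalizing x A A' ks l with
  | nil =>
    cases ks with
    | nil => simp [toSet_nil]
    | cons K ks => simp [Val] at hv
  | cons H hs ih =>
    cases ks with
    | nil => simp [Val] at hv
    | cons K ks =>
    cases l with
    | nil => simp [Val]
    | cons L ls =>
      obtain ⟨h1, h2, h3, h4⟩ := hv
      constructor
      · rintro ⟨⟨l1, l2, l3, l4⟩, hd⟩
        rw [Finset.disjoint_left] at hd
        have e1 : A' < K := by
          by_contra hc
          exact hd ((mem_toSet_cons x A' L ls (x, A')).2 (Or.inl ⟨rfl, l3, le_rfl⟩))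
            ((mem_toSet_cons x A K ks (x, A')).2 (Or.inl ⟨rfl, not_lt.1 hc, hA⟩))
        refine ⟨Nat.le_pred_of_lt e1, l2, l3, (ih (x := x+1) h4 (by omega)).1 ⟨l4, ?_⟩⟩
        rw [Finset.disjoint_left]
        intro p hp hq
        exact hd ((mem_toSet_cons _ _ _ _ _).2 (Or.inr hp)) ((mem_toSet_cons _ _ _ _ _).2 (Or.inr hq))
      · rintro ⟨l1, l2, l3, l4⟩
        have l1' : A' < K := by
          have : A' ≤ K - 1 := l1
          omega
        obtain ⟨i1, i2⟩ := (ih (x := x+1) h4 (by omega)).2 l4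
        refine ⟨⟨by omega, l2, l3, i1⟩, ?_⟩
        rw [Finset.disjoint_left] at i2 ⊢
        intro p hp hq
        rcases (mem_toSet_cons _ _ _ _ _).1 hp with a | a <;>
          rcases (mem_toSet_cons _ _ _ _ _).1 hq with b | b
        · omega
        · have := toSet_bd h4 b; omega
        · have := toSet_bd i1 a; omega
        · exact i2 a b

lemma planar {J j n : ℕ} {hs : List ℕ} {d x y A' : ℕ} {ks l : List ℕ} (hv : Val J (n :: hs) n ks)
    (hA : A' ≤ n) (hy : y = x + d) :
    (Val j (List.replicate d n ++ n :: hs) A' l ∧ Disjoint (toSet x A' l) (toSet y n ks)) ↔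
      Val j (List.replicate d n ++ ks.map Nat.pred) A' l := by
  induction d generalizing x A' l with
  | zero =>
    subst hy
    simpa using planar0 hv hA
  | succ d ih =>
    cases l with
    | nil => simp [Val, List.replicate_succ]
    | cons L ls =>
      simp only [List.replicate_succ, List.cons_append]
      constructor
      · rintro ⟨⟨l1, l2, l3, l4⟩, hd⟩
        refine ⟨l1, l2, l3, (ih (x := x+1) (by omega) (by omega)).1 ⟨l4, ?_⟩⟩
        rw [Finset.disjoint_left] at hd ⊢
        intro p hp hq
        exact hd ((mem_toSet_cons _ _ _ _ _).2 (Or.inr hp)) hq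
      · rintro ⟨l1, l2, l3, l4⟩
        obtain ⟨i1, i2⟩ := (ih (x := x+1) (by omega) (by omega)).2 l4
        refine ⟨⟨by omega, l2, l3, i1⟩, ?_⟩
        rw [Finset.disjoint_left] at i2 ⊢
        intro p hp hq
        rcases (mem_toSet_cons _ _ _ _ _).1 hp with a | a
        · have := toSet_bd hv hq; omega
        · exact i2 a hq

def TL (n r : ℕ) (hs : List ℕ) : Finset (Fin r → List ℕ) :=
  (Fintype.piFinset fun i : Fin r => LP (i+1) (List.replicate (r-i) n ++ hs) n).filter
    (fun l => ∀ i j : Fin r, i ≠ j → Disjoint (toSet (i+1) n (l i)) (toSet (j+1) n (l j)))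

lemma mem_TL (n r : ℕ) (hs : List ℕ) (l : Fin r → List ℕ) : l ∈ TL n r hs ↔
    (∀ i : Fin r, Val (i+1) (List.replicate (r-i) n ++ hs) n (l i)) ∧
    ∀ i j : Fin r, i ≠ j → Disjoint (toSet (i+1) n (l i)) (toSet (j+1) n (l j)) := by
  simp only [TL, Finset.mem_filter, Fintype.mem_piFinset, mem_LP]

noncomputable def NT (n r : ℕ) (hs : List ℕ) : ℚ[X] := ∑ l ∈ TL n r hs, X ^ (∑ i, exx (l i))

lemma TL_succ_iff (n s : ℕ) (hs : List ℕ) (f : Fin (s+1) → List ℕ) :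
    f ∈ TL n (s+1) hs ↔ Val (s+1) (n :: hs) n (f (Fin.last s)) ∧
      (fun i : Fin s => f i.castSucc) ∈ TL n s ((f (Fin.last s)).map Nat.pred) := by
  have hrep : ∀ i : Fin s, List.replicate (s + 1 - i) n ++ hs = List.replicate (s - i) n ++ n :: hs := by
    intro i
    have : s + 1 - (i : ℕ) = (s - i) + 1 := by omega
    rw [this, List.replicate_succ', List.append_assoc]
    rfl
  simp only [mem_TL, Fin.forall_fin_succ', Fin.val_castSucc, Fin.val_last, hrep]
  have hl : List.replicate (s + 1 - s) n ++ hs = n :: hs := by simp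
  rw [hl]
  constructor
  · rintro ⟨⟨h1, h2⟩, h3, h4⟩
    refine ⟨h2, fun i => (planar (x := i+1) h2 le_rfl (y := s+1) (by omega)).1 ⟨h1 i, (h3 i).2 (Fin.castSucc_ne_last i)⟩, ?_⟩
    intro i j hij
    exact (h3 i).1 j (fun e => hij (Fin.castSucc_injective _ e))
  · rintro ⟨h2, h1, h3⟩
    have h5 := fun i : Fin s => (planar (x := i+1) h2 le_rfl (y := s+1) (by omega)).2 (h1 i)
    refine ⟨⟨fun i => (h5 i).1, h2⟩, fun i => ⟨fun j hij => h3 i j (fun e => hij (by rw [e])), fun _ => (h5 i).2⟩,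
      fun i _ => (h5 i).2.symm, fun e => absurd rfl e⟩

lemma NT_succ (n s : ℕ) (hs : List ℕ) :
    NT n (s+1) hs = ∑ ks ∈ LP (s+1) (n :: hs) n, X ^ exx ks * NT n s (ks.map Nat.pred) := by
  simp only [NT, Finset.mul_sum]
  rw [Finset.sum_sigma']
  refine Finset.sum_nbij' (fun f => ⟨f (Fin.last s), fun i => f i.castSucc⟩)
    (fun p => Fin.snoc (α := fun _ => List ℕ) p.2 p.1) ?_ ?_ ?_ ?_ ?_
  · intro f hf
    have := (TL_succ_iff n s hs f).1 hf
    simp only [Finset.mem_sigma, mem_LP]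
    exact this
  · rintro ⟨ks, l⟩ hp
    simp only [Finset.mem_sigma, mem_LP] at hp
    rw [TL_succ_iff]
    simpa using hp
  · intro f _
    ext i : 1
    refine Fin.lastCases ?_ (fun i => ?_) i <;> simp
  · rintro ⟨ks, l⟩ _
    simp
  · intro f _
    rw [Fin.sum_univ_castSucc, pow_add, mul_comm]

lemma sum_LP_top (j n : ℕ) (hj : 1 ≤ j) (H : ℕ) (hH : n ≤ H) (hs : List ℕ) (φ : List ℕ → ℚ[X]) :
    ∑ ks ∈ LP j (H :: hs) n, X ^ exx ks * φ (ks.map Nat.pred) =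
      ∑ K ∈ range (n+1), PS j hs K (fun ks => φ ((K-1) :: ks)) := by
  rw [← sum_Icc_range n _ (PS_zero j hj _ _)]
  simp only [LP, if_pos hH]
  rw [Finset.sum_biUnion]
  · refine sum_congr rfl fun K _ => ?_
    rw [Finset.sum_image (by intro a _ b _ e; simpa using e)]
    rfl
  · intro a _ b _ hab
    simp only [Function.onFun]
    rw [Finset.disjoint_left]
    intro p hp hq
    simp only [Finset.mem_image] at hp hq
    obtain ⟨u, _, rfl⟩ := hp
    obtain ⟨v, _, e⟩ := hq
    simp at e
    exact hab e.1.symm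

lemma NN_eq_NT (n r : ℕ) (hs : List ℕ) : NN n r hs = NT n r hs := by
  induction r generalizing hs with
  | zero =>
    have : TL n 0 hs = {fun i => []} := by
      ext l
      rw [mem_TL, Finset.mem_singleton]
      refine ⟨fun _ => Subsingleton.elim _ _, fun _ => ⟨fun i => i.elim0, fun i => i.elim0⟩⟩
    simp [NN, NT, this]
  | succ s ih =>
    rw [NN_succ, NT_succ, ← sum_LP_top (s+1) n (by omega) n le_rfl hs (fun ks => NN n s ks)]
    simp only [ih]

lemma hts_length (h : ℕ → ℕ) (x d : ℕ) : (hts h x d).length = d := by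
  induction d generalizing x with
  | zero => rfl
  | succ d ih => simp [hts, ih]

lemma hts_split (h : ℕ → ℕ) (n x a d : ℕ) (hh : ∀ y, x ≤ y → y < x + a → h y = n) :
    hts h x (a + d) = List.replicate a n ++ hts h (x + a) d := by
  induction a generalizing x with
  | zero => simp
  | succ a ih =>
    have : a + 1 + d = (a + d) + 1 := by omega
    rw [this, hts, ih (x+1) (fun y h1 h2 => hh y (by omega) (by omega)), hh x le_rfl (by omega),
      List.replicate_succ, List.cons_append]
    have : x + 1 + a = x + (a + 1) := by omega
    rw [this]

lemma Wpoly_eq (n : ℕ) (h : ℕ → ℕ) (hanti : Antitone h) (j m d x : ℕ) (hj : 1 ≤ j) (hx : 1 ≤ x)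
    (hm : m = x + d) (hn : n ≤ h x) :
    Wpoly (ladder m n h) (x, n) (m, j) (m + n + 1) = ∑ a ∈ range (n+1), W j (hts h (x+1) d) a := by
  unfold Wpoly pathCount
  rw [genf (LP j (hts h x (d+1)) n) (toSet x n) ?_ cornersCount (m+n+1) ?_ (IsPath (ladder m n h) (x, n) (m, j)) ?_]
  · have := sum_LP_top j n hj (h x) hn (hts h (x+1) d) (fun _ => 1)
    simp only [mul_one] at this
    unfold W
    rw [← this]
    refine sum_congr rfl fun ks hks => ?_
    rw [corners_eq hx ((mem_LP _ _ _ _).1 hks)]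
  · intro a ha b hb e
    exact toSet_inj ((mem_LP _ _ _ _).1 ha) ((mem_LP _ _ _ _).1 hb) e
  · intro ks hks
    have hv := (mem_LP _ _ _ _).1 hks
    rw [corners_eq hx hv]
    have h1 := exx_le ks
    have h2 := Val_length hv
    rw [hts_length] at h2
    omega
  · intro C
    rw [isPath_iff n h hanti j m d x n hj hx hm le_rfl C]
    simp only [mem_LP, eq_comm]

lemma WTpoly_eq (m n r : ℕ) (h : ℕ → ℕ) (hanti : Antitone h) (hrm : r ≤ m)
    (hh : ∀ y, 1 ≤ y → y ≤ r → h y = n) :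
    WTpoly (ladder m n h) (fun i : Fin r => ((i : ℕ) + 1, n))
          (fun i : Fin r => (m, (i : ℕ) + 1)) (r * (m + n) + 1) = NT n r (hts h (r+1) (m-r)) := by
  have hl : ∀ i : Fin r, List.replicate (r - i) n ++ hts h (r+1) (m-r) = hts h (i+1) ((m-i-1)+1) := by
    intro i
    have e1 : (m - i - 1) + 1 = (r - i) + (m - r) := by omega
    have e2 : r + 1 = (i + 1) + (r - i) := by omega
    rw [e1, e2]
    exact (hts_split h n (i+1) (r-i) (m-r) (fun y h1 h2 => hh y (by omega) (by omega))).symm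
  have key := genf (TL n r (hts h (r+1) (m-r))) (fun l (i : Fin r) => toSet (i+1) n (l i)) ?_
    (fun C => ∑ i : Fin r, cornersCount (C i)) (r * (m+n) + 1) ?_
    (fun C => (∀ i : Fin r, IsPath (ladder m n h) ((i:ℕ)+1, n) (m, (i:ℕ)+1) (C i)) ∧
      (∀ i j : Fin r, i ≠ j → Disjoint (C i) (C j))) ?_
  · unfold WTpoly tupleCount NT
    simp only [and_assoc] at key
    rw [key]
    refine sum_congr rfl fun l hl => ?_
    congr 1
    exact sum_congr rfl fun i _ => corners_eq (by omega) (((mem_TL _ _ _ _).1 hl).1 i)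
  · intro a ha b hb e
    ext i : 1
    exact toSet_inj (((mem_TL _ _ _ _).1 ha).1 i) (((mem_TL _ _ _ _).1 hb).1 i) (congrFun e i)
  · intro l hl'
    have : ∑ i : Fin r, cornersCount (toSet (i+1) n (l i)) ≤ ∑ i : Fin r, (m + n) := by
      refine Finset.sum_le_sum fun i _ => ?_
      have hv := ((mem_TL _ _ _ _).1 hl').1 i
      rw [corners_eq (by omega) hv]
      have h1 := exx_le (l i)
      have h2 := Val_length hv
      rw [hl, hts_length] at h2
      omega
    simp only [Finset.sum_const, Finset.card_univ, Fintype.card_fin, smul_eq_mul] at this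
    exact Nat.lt_succ_of_le this
  · intro C
    have hp : ∀ i : Fin r, _ := fun i => isPath_iff n h hanti (i+1) m (m-i-1) (i+1) n (by omega) (by omega) (by omega) le_rfl (C i)
    simp only [hp, mem_TL, hl]
    constructor
    · rintro ⟨h1, h2⟩
      choose l h3 h4 using h1
      refine ⟨l, ⟨h3, fun i j hij => ?_⟩, ?_⟩
      · rw [← h4, ← h4]; exact h2 i j hij
      · ext i : 1
        exact (h4 i).symm
    · rintro ⟨l, ⟨h1, h2⟩, rfl⟩
      exact ⟨fun i => ⟨l i, h1 i, rfl⟩, h2⟩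

end CH

/-- The Conca–Herzog conjecture (Theorem of Krattenthaler–Prohaska): in a one-sided ladder
region `Y` with height function `h`, with `Pᵢ = (i,n)` and `Qᵢ = (m,i)` points of `Y` for
`i = 1,…,r`, `det[W_Y(Pᵢ,Q_j)] = t^{C(r,2)} · W_Y(P,Q)`, where `W_Y(Pᵢ,Q_j)` counts single
paths in `Y` by corners and `W_Y(P,Q)` counts `r`-tuples of pairwise disjoint paths from
`Pᵢ` to `Qᵢ` by total corners. -/
theorem conca_herzog (m n r : ℕ) (h : ℕ → ℕ) (hanti : Antitone h) (h1 : h 1 = n)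
    (hr : 1 ≤ r) (hrm : r ≤ m) (hrn : r ≤ n) (hP : n ≤ h r) (hQ : r ≤ h m) :
    Matrix.det (Matrix.of fun i j : Fin r =>
        Wpoly (ladder m n h) ((i : ℕ) + 1, n) (m, (j : ℕ) + 1) (m + n + 1)) =
      X ^ r.choose 2 *
        WTpoly (ladder m n h) (fun i : Fin r => ((i : ℕ) + 1, n))
          (fun i : Fin r => (m, (i : ℕ) + 1)) (r * (m + n) + 1) := by
  have hh : ∀ y, 1 ≤ y → y ≤ r → h y = n := by
    intro y y1 y2
    have a1 := hanti y1
    have a2 := hanti y2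
    omega
  rw [CH.WTpoly_eq m n r h hanti hrm hh, ← CH.NN_eq_NT, ← CH.det_rows]
  congr 1
  ext1 i j
  simp only [Matrix.of_apply]
  rw [CH.Wpoly_eq n h hanti (j+1) m (m-i-1) (i+1) (by omega) (by omega) (by omega)
    (by rw [hh _ (by omega) (by omega)])]
  have e1 : m - i - 1 = (r - 1 - i) + (m - r) := by omega
  have e2 : r + 1 = (i + 1 + 1) + (r - 1 - i) := by omega
  rw [e1, e2, CH.hts_split h n (i+1+1) (r-1-i) (m-r) (fun y h1 h2 => hh y (by omega) (by omega))]
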